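/- If u solves the cylindrical Helmholtz equation with parameter k, then the function X₆u : (r,θ,z) ↦ −z·cos θ · u_r(r,θ,z) + (z·sin θ / r) · u_θ(r,θ,z) + r·cos θ · u_z(r,θ,z) also solves the cylindrical Helmholtz equation with parameter k on the region r > 0. (Infinitesimal invariance under the symmetry generator X₆ = −z cos θ ∂_r + (z sin θ / r) ∂_θ + r cos θ ∂_z of Theorem 1.) -/

import Mathlib

/-- Partial derivative with respect to the first argument. -/
noncomputable def p1 (u : ℝ → ℝ → ℝ → ℝ) (r θ z : ℝ) : ℝ :=
  deriv (fun s => u s θ z) r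

/-- Partial derivative with respect to the second argument. -/
noncomputable def p2 (u : ℝ → ℝ → ℝ → ℝ) (r θ z : ℝ) : ℝ :=
  deriv (fun s => u r s z) θ

/-- Partial derivative with respect to the third argument. -/
noncomputable def p3 (u : ℝ → ℝ → ℝ → ℝ) (r θ z : ℝ) : ℝ :=
  deriv (fun s => u r θ s) z

/-- The cylindrical Helmholtz equation holds at the point `(r, θ, z)`:
`u_rr + (1/r)·u_r + (1/r²)·u_θθ + u_zz + k²·u = 0`. -/
def CHEat (k : ℝ) (u : ℝ → ℝ → ℝ → ℝ) (r θ z : ℝ) : Prop :=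
  p1 (p1 u) r θ z + (1 / r) * p1 u r θ z + (1 / r ^ 2) * p2 (p2 u) r θ z
    + p3 (p3 u) r θ z + k ^ 2 * u r θ z = 0

/-- `u` is a smooth function solving the cylindrical Helmholtz equation with
parameter `k` (at every point with `r > 0`). -/
def SolvesCHE (k : ℝ) (u : ℝ → ℝ → ℝ → ℝ) : Prop :=
  ContDiff ℝ (⊤ : ℕ∞) (fun p : ℝ × ℝ × ℝ => u p.1 p.2.1 p.2.2) ∧
    ∀ r θ z : ℝ, 0 < r → CHEat k u r θ z



def Sm3 (u : ℝ → ℝ → ℝ → ℝ) : Prop :=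
  ContDiff ℝ (⊤ : ℕ∞) (fun p : ℝ × ℝ × ℝ => u p.1 p.2.1 p.2.2)

lemma Sm3.hd {u : ℝ → ℝ → ℝ → ℝ} (h : Sm3 u) (p : ℝ × ℝ × ℝ) :
    HasFDerivAt (fun p : ℝ × ℝ × ℝ => u p.1 p.2.1 p.2.2)
      (fderiv ℝ (fun p : ℝ × ℝ × ℝ => u p.1 p.2.1 p.2.2) p) p :=
  ((ContDiff.differentiable h (by simp)) p).hasFDerivAt

lemma Sm3.h1' {u : ℝ → ℝ → ℝ → ℝ} (h : Sm3 u) (r θ z : ℝ) :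
    HasDerivAt (fun s => u s θ z)
      (fderiv ℝ (fun p : ℝ × ℝ × ℝ => u p.1 p.2.1 p.2.2) (r, θ, z) (1, 0, 0)) r :=
  (h.hd (r, θ, z)).comp_hasDerivAt (f := fun s => (s, θ, z)) r
    ((hasDerivAt_id r).prodMk ((hasDerivAt_const r θ).prodMk (hasDerivAt_const r z)))

lemma Sm3.h2' {u : ℝ → ℝ → ℝ → ℝ} (h : Sm3 u) (r θ z : ℝ) :
    HasDerivAt (fun s => u r s z)
      (fderiv ℝ (fun p : ℝ × ℝ × ℝ => u p.1 p.2.1 p.2.2) (r, θ, z) (0, 1, 0)) θ :=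
  (h.hd (r, θ, z)).comp_hasDerivAt (f := fun s => (r, s, z)) θ
    ((hasDerivAt_const θ r).prodMk ((hasDerivAt_id θ).prodMk (hasDerivAt_const θ z)))

lemma Sm3.h3' {u : ℝ → ℝ → ℝ → ℝ} (h : Sm3 u) (r θ z : ℝ) :
    HasDerivAt (fun s => u r θ s)
      (fderiv ℝ (fun p : ℝ × ℝ × ℝ => u p.1 p.2.1 p.2.2) (r, θ, z) (0, 0, 1)) z :=
  (h.hd (r, θ, z)).comp_hasDerivAt (f := fun s => (r, θ, s)) z
    ((hasDerivAt_const z r).prodMk ((hasDerivAt_const z θ).prodMk (hasDerivAt_id z)))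

lemma Sm3.smv {u : ℝ → ℝ → ℝ → ℝ} (h : Sm3 u) (v : ℝ × ℝ × ℝ) :
    ContDiff ℝ (⊤ : ℕ∞)
      (fun p => fderiv ℝ (fun p : ℝ × ℝ × ℝ => u p.1 p.2.1 p.2.2) p v) :=
  (ContDiff.fderiv_right (m := (⊤ : ℕ∞)) h (by simp)).clm_apply contDiff_const

lemma Sm3.ff {u : ℝ → ℝ → ℝ → ℝ} (h : Sm3 u) (p v w : ℝ × ℝ × ℝ) :
    fderiv ℝ (fun p => fderiv ℝ (fun p : ℝ × ℝ × ℝ => u p.1 p.2.1 p.2.2) p v) p w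
     = fderiv ℝ (fun p => fderiv ℝ (fun p : ℝ × ℝ × ℝ => u p.1 p.2.1 p.2.2) p w) p v := by
  have hd : DifferentiableAt ℝ (fderiv ℝ (fun p : ℝ × ℝ × ℝ => u p.1 p.2.1 p.2.2)) p :=
    (ContDiff.differentiable (ContDiff.fderiv_right (m := (⊤ : ℕ∞)) h (by simp)) (by simp)) p
  have hs : IsSymmSndFDerivAt ℝ (fun p : ℝ × ℝ × ℝ => u p.1 p.2.1 p.2.2) p :=
    (ContDiff.contDiffAt h).isSymmSndFDerivAt (by
      rw [minSmoothness_of_isRCLikeNormedField]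
      exact WithTop.coe_le_coe.2 (le_top : (2 : ℕ∞) ≤ ⊤))
  have e : ∀ a b : ℝ × ℝ × ℝ,
      fderiv ℝ (fun p => fderiv ℝ (fun p : ℝ × ℝ × ℝ => u p.1 p.2.1 p.2.2) p a) p b
      = fderiv ℝ (fderiv ℝ (fun p : ℝ × ℝ × ℝ => u p.1 p.2.1 p.2.2)) p b a := by
    intro a b
    rw [fderiv_clm_apply hd (differentiableAt_const a)]
    simp
  rw [e, e, hs.eq]

lemma Sm3.e1 {u : ℝ → ℝ → ℝ → ℝ} (h : Sm3 u) (r θ z : ℝ) :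
    p1 u r θ z = fderiv ℝ (fun p : ℝ × ℝ × ℝ => u p.1 p.2.1 p.2.2) (r, θ, z) (1, 0, 0) :=
  (h.h1' r θ z).deriv

lemma Sm3.h1 {u : ℝ → ℝ → ℝ → ℝ} (h : Sm3 u) (r θ z : ℝ) :
    HasDerivAt (fun s => u s θ z) (p1 u r θ z) r := by
  rw [h.e1]; exact h.h1' r θ z

lemma Sm3.s1 {u : ℝ → ℝ → ℝ → ℝ} (h : Sm3 u) : Sm3 (p1 u) := by
  unfold Sm3
  simp only [h.e1]
  exact h.smv (1, 0, 0)

lemma Sm3.f1 {u : ℝ → ℝ → ℝ → ℝ} (h : Sm3 u) :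
    (fun p : ℝ × ℝ × ℝ => p1 u p.1 p.2.1 p.2.2) =
      fun p => fderiv ℝ (fun p : ℝ × ℝ × ℝ => u p.1 p.2.1 p.2.2) p (1, 0, 0) := by
  funext p
  exact h.e1 _ _ _

lemma Sm3.e2 {u : ℝ → ℝ → ℝ → ℝ} (h : Sm3 u) (r θ z : ℝ) :
    p2 u r θ z = fderiv ℝ (fun p : ℝ × ℝ × ℝ => u p.1 p.2.1 p.2.2) (r, θ, z) (0, 1, 0) :=
  (h.h2' r θ z).deriv

lemma Sm3.h2 {u : ℝ → ℝ → ℝ → ℝ} (h : Sm3 u) (r θ z : ℝ) :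
    HasDerivAt (fun s => u r s z) (p2 u r θ z) θ := by
  rw [h.e2]; exact h.h2' r θ z

lemma Sm3.s2 {u : ℝ → ℝ → ℝ → ℝ} (h : Sm3 u) : Sm3 (p2 u) := by
  unfold Sm3
  simp only [h.e2]
  exact h.smv (0, 1, 0)

lemma Sm3.f2 {u : ℝ → ℝ → ℝ → ℝ} (h : Sm3 u) :
    (fun p : ℝ × ℝ × ℝ => p2 u p.1 p.2.1 p.2.2) =
      fun p => fderiv ℝ (fun p : ℝ × ℝ × ℝ => u p.1 p.2.1 p.2.2) p (0, 1, 0) := by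
  funext p
  exact h.e2 _ _ _

lemma Sm3.e3 {u : ℝ → ℝ → ℝ → ℝ} (h : Sm3 u) (r θ z : ℝ) :
    p3 u r θ z = fderiv ℝ (fun p : ℝ × ℝ × ℝ => u p.1 p.2.1 p.2.2) (r, θ, z) (0, 0, 1) :=
  (h.h3' r θ z).deriv

lemma Sm3.h3 {u : ℝ → ℝ → ℝ → ℝ} (h : Sm3 u) (r θ z : ℝ) :
    HasDerivAt (fun s => u r θ s) (p3 u r θ z) z := by
  rw [h.e3]; exact h.h3' r θ z

lemma Sm3.s3 {u : ℝ → ℝ → ℝ → ℝ} (h : Sm3 u) : Sm3 (p3 u) := by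
  unfold Sm3
  simp only [h.e3]
  exact h.smv (0, 0, 1)

lemma Sm3.f3 {u : ℝ → ℝ → ℝ → ℝ} (h : Sm3 u) :
    (fun p : ℝ × ℝ × ℝ => p3 u p.1 p.2.1 p.2.2) =
      fun p => fderiv ℝ (fun p : ℝ × ℝ × ℝ => u p.1 p.2.1 p.2.2) p (0, 0, 1) := by
  funext p
  exact h.e3 _ _ _

lemma Sm3.c21 {u : ℝ → ℝ → ℝ → ℝ} (h : Sm3 u) : p2 (p1 u) = p1 (p2 u) := by
  funext r θ z
  rw [h.s1.e2, h.s2.e1, h.f1, h.f2, h.ff]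

lemma Sm3.c31 {u : ℝ → ℝ → ℝ → ℝ} (h : Sm3 u) : p3 (p1 u) = p1 (p3 u) := by
  funext r θ z
  rw [h.s1.e3, h.s3.e1, h.f1, h.f3, h.ff]

lemma Sm3.c32 {u : ℝ → ℝ → ℝ → ℝ} (h : Sm3 u) : p3 (p2 u) = p2 (p3 u) := by
  funext r θ z
  rw [h.s2.e3, h.s3.e2, h.f2, h.f3, h.ff]

/-- Infinitesimal invariance under `X₆ = −z cos θ ∂_r + (z sin θ / r) ∂_θ + r cos θ ∂_z`:
if `u` solves the cylindrical Helmholtz equation with parameter `k`, then so does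
`X₆u = −z cos θ · u_r + (z sin θ / r) · u_θ + r cos θ · u_z` on the region `r > 0`. -/
theorem che_X6_infinitesimal_symmetry (k : ℝ) (u : ℝ → ℝ → ℝ → ℝ)
    (hu : SolvesCHE k u) :
    ∀ r θ z : ℝ, 0 < r →
      CHEat k (fun r θ z =>
        -z * Real.cos θ * p1 u r θ z + (z * Real.sin θ / r) * p2 u r θ z
          + r * Real.cos θ * p3 u r θ z) r θ z := by
  intro r θ z hr
  obtain ⟨hs, hE⟩ := hu
  have h : Sm3 u := hs
  clear hs
  have hr0 : r ≠ 0 := hr.ne'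
  -- differentiated equation
  have d1 := (((((h.s1.s1.h1 r θ z).add (((hasDerivAt_inv hr0)).mul (h.s1.h1 r θ z))).add
    ((((hasDerivAt_id r).pow 2).inv (pow_ne_zero 2 hr0)).mul (h.s2.s2.h1 r θ z))).add
    (h.s3.s3.h1 r θ z)).add ((h.h1 r θ z).const_mul (k ^ 2)))
  have d2 := (((((h.s1.s1.h2 r θ z).add ((h.s1.h2 r θ z).const_mul (1 / r))).add
    ((h.s2.s2.h2 r θ z).const_mul (1 / r ^ 2))).add
    (h.s3.s3.h2 r θ z)).add ((h.h2 r θ z).const_mul (k ^ 2)))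
  have d3 := (((((h.s1.s1.h3 r θ z).add ((h.s1.h3 r θ z).const_mul (1 / r))).add
    ((h.s2.s2.h3 r θ z).const_mul (1 / r ^ 2))).add
    (h.s3.s3.h3 r θ z)).add ((h.h3 r θ z).const_mul (k ^ 2)))
  have q1 := d1.unique ((hasDerivAt_const r (0:ℝ)).congr_of_eventuallyEq (by
    filter_upwards [lt_mem_nhds hr] with s hs
    have := hE s θ z hs
    unfold CHEat at this
    simpa using this))
  have q2 := d2.unique ((hasDerivAt_const θ (0:ℝ)).congr_of_eventuallyEq (by
    filter_upwards with s
    have := hE r s z hr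
    unfold CHEat at this
    simpa using this))
  have q3 := d3.unique ((hasDerivAt_const z (0:ℝ)).congr_of_eventuallyEq (by
    filter_upwards with s
    have := hE r θ s hr
    unfold CHEat at this
    simpa using this))
  have q0 := hE r θ z hr
  clear d1 d2 d3
  set X : ℝ → ℝ → ℝ → ℝ := fun r θ z =>
        -z * Real.cos θ * p1 u r θ z + (z * Real.sin θ / r) * p2 u r θ z
          + r * Real.cos θ * p3 u r θ z with hX
  have X1 : ∀ s, 0 < s → p1 X s θ z = -z * Real.cos θ * p1 (p1 u) s θ z
      + (z * Real.sin θ * (-(s ^ 2)⁻¹) * p2 u s θ z + z * Real.sin θ * s⁻¹ * p1 (p2 u) s θ z)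
      + (Real.cos θ * p3 u s θ z + s * Real.cos θ * p1 (p3 u) s θ z) := by
    intro s hs
    have := (((h.s1.h1 s θ z).const_mul (-z * Real.cos θ)).add
      (((hasDerivAt_inv hs.ne').const_mul (z * Real.sin θ)).mul (h.s2.h1 s θ z))).add
      (((hasDerivAt_id s).mul_const (Real.cos θ)).mul (h.s3.h1 s θ z))
    refine Eq.trans this.deriv ?_
    simp
  have X2 : ∀ s, p2 X r s z = (-z * -Real.sin s * p1 u r s z + -z * Real.cos s * p2 (p1 u) r s z)
      + (z / r * Real.cos s * p2 u r s z + z / r * Real.sin s * p2 (p2 u) r s z)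
      + (r * -Real.sin s * p3 u r s z + r * Real.cos s * p2 (p3 u) r s z) := by
    intro s
    have := ((((Real.hasDerivAt_cos s).const_mul (-z)).mul (h.s1.h2 r s z)).add
      (((Real.hasDerivAt_sin s).const_mul (z / r)).mul (h.s2.h2 r s z))).add
      (((Real.hasDerivAt_cos s).const_mul r).mul (h.s3.h2 r s z))
    refine HasDerivAt.deriv (this.congr_of_eventuallyEq ?_)
    filter_upwards with t
    simp only [hX, Pi.add_apply, Pi.mul_apply, Pi.neg_apply, id]
    ring
  have X3 : ∀ s, p3 X r θ s = (-1 * Real.cos θ * p1 u r θ s + -s * Real.cos θ * p3 (p1 u) r θ s)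
      + (Real.sin θ / r * p2 u r θ s + s * (Real.sin θ / r) * p3 (p2 u) r θ s)
      + r * Real.cos θ * p3 (p3 u) r θ s := by
    intro s
    have := ((((hasDerivAt_id s).neg.mul_const (Real.cos θ)).mul (h.s1.h3 r θ s)).add
      (((hasDerivAt_id s).mul_const (Real.sin θ / r)).mul (h.s2.h3 r θ s))).add
      ((h.s3.h3 r θ s).const_mul (r * Real.cos θ))
    refine Eq.trans (HasDerivAt.deriv (this.congr_of_eventuallyEq ?_)) ?_
    · filter_upwards with t
      simp only [hX, Pi.add_apply, Pi.mul_apply, Pi.neg_apply, id]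
      ring
    · simp
  have X11 := ((((h.s1.s1.h1 r θ z).const_mul (-z * Real.cos θ)).add
      ((((((hasDerivAt_id r).pow 2).inv (pow_ne_zero 2 hr0)).neg.const_mul
          (z * Real.sin θ)).mul (h.s2.h1 r θ z)).add
       (((hasDerivAt_inv hr0).const_mul (z * Real.sin θ)).mul (h.s2.s1.h1 r θ z)))).add
      (((h.s3.h1 r θ z).const_mul (Real.cos θ)).add
       (((hasDerivAt_id r).mul_const (Real.cos θ)).mul (h.s3.s1.h1 r θ z)))).congr_of_eventuallyEq
      (f₁ := fun s => p1 X s θ z) (by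
        filter_upwards [lt_mem_nhds hr] with s hs
        rw [X1 s hs]
        simp)
  have X22 := ((((((Real.hasDerivAt_sin θ).neg.const_mul (-z)).mul (h.s1.h2 r θ z)).add
       (((Real.hasDerivAt_cos θ).const_mul (-z)).mul (h.s1.s2.h2 r θ z))).add
      ((((Real.hasDerivAt_cos θ).const_mul (z / r)).mul (h.s2.h2 r θ z)).add
       (((Real.hasDerivAt_sin θ).const_mul (z / r)).mul (h.s2.s2.h2 r θ z)))).add
      ((((Real.hasDerivAt_sin θ).neg.const_mul r).mul (h.s3.h2 r θ z)).add
       (((Real.hasDerivAt_cos θ).const_mul r).mul (h.s3.s2.h2 r θ z)))).congr_of_eventuallyEq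
      (f₁ := fun s => p2 X r s z) (by
        filter_upwards with s
        rw [X2 s]
        simp)
  have X33 := (((((h.s1.h3 r θ z).const_mul (-1 * Real.cos θ)).add
       (((hasDerivAt_id z).neg.mul_const (Real.cos θ)).mul (h.s1.s3.h3 r θ z))).add
      (((h.s2.h3 r θ z).const_mul (Real.sin θ / r)).add
       (((hasDerivAt_id z).mul_const (Real.sin θ / r)).mul (h.s2.s3.h3 r θ z)))).add
      ((h.s3.s3.h3 r θ z).const_mul (r * Real.cos θ))).congr_of_eventuallyEq
      (f₁ := fun s => p3 X r θ s) (by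
        filter_upwards with s
        rw [X3 s]
        simp)
  have Y1 : p1 (p1 X) r θ z = _ := X11.deriv
  have Y2 : p2 (p2 X) r θ z = _ := X22.deriv
  have Y3 : p3 (p3 X) r θ z = _ := X33.deriv
  unfold CHEat at q0 ⊢
  rw [Y1, Y2, Y3, X1 r hr]
  clear Y1 Y2 Y3 X11 X22 X33 X1 X2 X3
  simp only [hX, h.c21, h.c31, h.c32, h.s1.c21, h.s1.c31, h.s1.c32, h.s2.c21, h.s2.c31, h.s2.c32,
    h.s3.c21, h.s3.c31, h.s3.c32, id, Pi.pow_apply, Pi.neg_apply, Pi.inv_apply] at q0 q1 q2 q3 ⊢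
  clear hX X hE
  generalize Real.cos θ = c at *
  generalize Real.sin θ = d at *
  have hi : r * r⁻¹ = 1 := mul_inv_cancel₀ hr0
  linear_combination (-z * c) * q1 + (z * d / r) * q2 + (r * c) * q3
    + (-2 * z * c * r⁻¹ ^ 3 * p2 (p2 u) r θ z + 2 * z * d * r⁻¹ ^ 3 * p2 u r θ z
      - c * r⁻¹ * p3 u r θ z - 2 * d * r⁻¹ * p2 (p3 u) r θ z) * hi
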